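/- Let r̃ ∈ L^∞(I) and define L̃ : H^1_{0L}(I) → (H^1_{0L}(I))' by L̃(u)(v) = ∫₀¹ u'v' − ∫₀¹ r̃ u v. (i) Fix δ > 0 and consider the family L̃_μ(u)(v) = ∫₀¹ u'v' + ∫₀¹ (r̃⁻+δ)uv − μ∫₀¹ (r̃⁺+δ)uv, so that L̃ = L̃₁. If μ = 1 is not an eigenvalue of L̃_μ (i.e. the problem −u'' + (r̃⁻+δ)u = μ(r̃⁺+δ)u, u(0)=0, u'(1)=0 has no nonzero solution for μ=1), then L̃ is surjective. (ii) In particular, if ‖r̃⁺‖_∞ < c_p^{-2} = π²/4, then L̃ is surjective. -/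

import Mathlib

open MeasureTheory Set

noncomputable def mu01 : Measure ℝ := volume.restrict (Ioo 0 1)

/-- `H^1_{0L}(I)` modelled isometrically by the `L²(I)` space of derivatives. -/
noncomputable abbrev E := Lp ℝ 2 mu01

noncomputable def U (g : E) : ℝ → ℝ := fun t => ∫ s in Ioc 0 t, (g : ℝ → ℝ) s ∂mu01

/-- The operator `L̃(u)(v) = ∫₀¹ u'v' − ∫₀¹ r̃ u v` on `H^1_{0L}(I)`. -/
noncomputable def Ltilde (rt : ℝ → ℝ) (g w : E) : ℝ :=
  (∫ s, (g : ℝ → ℝ) s * (w : ℝ → ℝ) s ∂mu01) - ∫ s, rt s * U g s * U w s ∂mu01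

/-- `(μ, g)` is a weak eigenpair of `-u'' + (r̃⁻+δ)u = μ(r̃⁺+δ)u`, `u(0)=0`, `u'(1)=0`. -/
def EigenEqSplit (rt : ℝ → ℝ) (δ μ : ℝ) (g : E) : Prop :=
  ∀ w : E, (∫ s, (g : ℝ → ℝ) s * (w : ℝ → ℝ) s ∂mu01)
    + (∫ s, (max (-rt s) 0 + δ) * U g s * U w s ∂mu01)
    = μ * ∫ s, (max (rt s) 0 + δ) * U g s * U w s ∂mu01

open scoped RealInnerProductSpace ENNReal

instance isProbabilityMeasure_mu01 : IsProbabilityMeasure mu01 :=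
  ⟨by simp [mu01]⟩

instance nullSingletonClass_mu01 : NullSingletonClass mu01 := by
  unfold mu01; infer_instance

lemma ae_mem_Ioo_mu01 : ∀ᵐ t ∂mu01, t ∈ Ioo (0 : ℝ) 1 :=
  ae_restrict_mem measurableSet_Ioo

lemma integrable_E (g : E) : Integrable (g : ℝ → ℝ) mu01 :=
  (Lp.memLp g).integrable one_le_two

lemma norm_E_le_of_ae_bound {g : E} {C : ℝ} (hC : 0 ≤ C)
    (h : ∀ᵐ t ∂mu01, |(g : ℝ → ℝ) t| ≤ C) : ‖g‖ ≤ C := by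
  simpa [measureUnivNNReal] using Lp.norm_le_of_ae_bound (f := g) hC h

lemma inner_E_eq (g w : E) : ⟪g, w⟫ = ∫ s, (g : ℝ → ℝ) s * (w : ℝ → ℝ) s ∂mu01 := by
  simp [L2.inner_def, mul_comm]

lemma U_eq_inner (g : E) (t : ℝ) :
    U g t = ⟪indicatorConstLp 2 (measurableSet_Ioc (a := (0 : ℝ)) (b := t))
      (measure_ne_top mu01 _) (1 : ℝ), g⟫ := by
  rw [L2.inner_indicatorConstLp_one]; rfl

lemma U_add (g w : E) (t : ℝ) : U (g + w) t = U g t + U w t := by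
  simp only [U_eq_inner, inner_add_right]

lemma U_smul (c : ℝ) (g : E) (t : ℝ) : U (c • g) t = c * U g t := by
  simp only [U_eq_inner, inner_smul_right]

lemma abs_U_sub_le (g : E) {s t : ℝ} (hs : 0 ≤ s) (hst : s ≤ t) :
    |U g t - U g s| ≤ √(t - s) * ‖g‖ := by
  have h : U g t - U g s = ⟪indicatorConstLp 2 (measurableSet_Ioc (a := s) (b := t))
      (measure_ne_top mu01 _) (1 : ℝ), g⟫ := by
    rw [L2.inner_indicatorConstLp_one, sub_eq_iff_eq_add', U, U,
      ← setIntegral_union (Ioc_disjoint_Ioc_of_le le_rfl) measurableSet_Ioc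
        (integrable_E g).integrableOn (integrable_E g).integrableOn, Ioc_union_Ioc_eq_Ioc hs hst]
  rw [h]
  refine (abs_real_inner_le_norm _ _).trans ?_
  gcongr
  refine norm_indicatorConstLp_le.trans ?_
  rw [norm_one, one_mul, Real.sqrt_eq_rpow, ENNReal.toReal_ofNat]
  gcongr
  refine (measureReal_mono (μ := volume) (s₁ := Ioc s t ∩ Ioo 0 1) inter_subset_left
    (by simp)).trans' ?_ |>.trans (by simp [hst])
  simp [mu01, measureReal_restrict_apply]

lemma abs_U_le (g : E) {t : ℝ} (ht : t ∈ Ioo (0 : ℝ) 1) : |U g t| ≤ ‖g‖ := by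
  have h := abs_U_sub_le g le_rfl ht.1.le
  have h0 : U g 0 = 0 := by simp [U]
  rw [h0, sub_zero, sub_zero] at h
  refine h.trans (mul_le_of_le_one_left (norm_nonneg _) ?_)
  exact Real.sqrt_le_one.2 ht.2.le

lemma memLp_U (g : E) : MemLp (U g) 2 mu01 := by
  refine MemLp.of_bound ?_ ‖g‖ ?_
  · have hc : Continuous fun t => ∫ s in (0 : ℝ)..t, (g : ℝ → ℝ) s ∂mu01 :=
      intervalIntegral.continuous_primitive (fun _ _ => (integrable_E g).intervalIntegrable) 0
    refine hc.aestronglyMeasurable.congr ?_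
    filter_upwards [ae_mem_Ioo_mu01] with t ht
    rw [intervalIntegral.integral_of_le ht.1.le, U]
  · filter_upwards [ae_mem_Ioo_mu01] with t ht using abs_U_le g ht

/-- The Volterra operator `u' ↦ u` on `L²(I)`. -/
noncomputable def volterra : E →L[ℝ] E :=
  LinearMap.mkContinuous
    { toFun := fun g => (memLp_U g).toLp (U g)
      map_add' := fun g w => by
        rw [← MemLp.toLp_add]
        exact MemLp.toLp_congr _ _ (.of_forall fun t => U_add g w t)
      map_smul' := fun c g => by
        rw [RingHom.id_apply, ← MemLp.toLp_const_smul]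
        exact MemLp.toLp_congr _ _ (.of_forall fun t => U_smul c g t) }
    1 fun g => by
      rw [one_mul]
      refine norm_E_le_of_ae_bound (g := (memLp_U g).toLp (U g)) (norm_nonneg g) ?_
      filter_upwards [(memLp_U g).coeFn_toLp, ae_mem_Ioo_mu01] with t ht ht'
      rw [ht]
      exact abs_U_le g ht'

lemma coeFn_volterra (g : E) : (volterra g : ℝ → ℝ) =ᵐ[mu01] U g :=
  (memLp_U g).coeFn_toLp

/-- Finite-rank approximation of `volterra`, sampling `U g` on the grid of mesh `1 / n`. -/
noncomputable def volterraApprox (n : ℕ) : E →L[ℝ] E :=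
  ∑ i ∈ Finset.range n, ContinuousLinearMap.smulRight
    (innerSL ℝ (indicatorConstLp 2 (measurableSet_Ioc (a := (0 : ℝ)) (b := i / n))
      (measure_ne_top mu01 _) (1 : ℝ)))
    (indicatorConstLp 2 (measurableSet_Ico (a := (i / n : ℝ)) (b := (i + 1) / n))
      (measure_ne_top mu01 _) (1 : ℝ))

lemma volterraApprox_apply (n : ℕ) (g : E) :
    volterraApprox n g = ∑ i ∈ Finset.range n, U g (i / n) •
      indicatorConstLp 2 (measurableSet_Ico (a := (i / n : ℝ)) (b := (i + 1) / n))
      (measure_ne_top mu01 _) (1 : ℝ) := by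
  simp [volterraApprox, U_eq_inner]

lemma coeFn_volterraApprox (n : ℕ) (g : E) : (volterraApprox n g : ℝ → ℝ) =ᵐ[mu01]
    fun t => ∑ i ∈ Finset.range n, U g (i / n) * (Ico (i / n : ℝ) ((i + 1) / n)).indicator 1 t := by
  rw [volterraApprox_apply]
  refine (Lp.coeFn_finsetSum _ _).trans ?_
  have h : ∀ᵐ t ∂mu01, ∀ i ∈ Finset.range n, (U g (i / n) •
      indicatorConstLp 2 (measurableSet_Ico (a := (i / n : ℝ)) (b := (i + 1) / n))
      (measure_ne_top mu01 _) (1 : ℝ) : E) t =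
      U g (i / n) * (Ico (i / n : ℝ) ((i + 1) / n)).indicator 1 t := by
    rw [Finset.eventually_all]
    intro i _
    filter_upwards [Lp.coeFn_smul (U g (i / n)) (indicatorConstLp 2
      (measurableSet_Ico (a := (i / n : ℝ)) (b := (i + 1) / n))
      (measure_ne_top mu01 _) (1 : ℝ)), indicatorConstLp_coeFn (p := 2)
      (hs := measurableSet_Ico (a := (i / n : ℝ)) (b := (i + 1) / n))
      (hμs := measure_ne_top mu01 _) (c := (1 : ℝ))] with t h1 h2
    rw [h1, Pi.smul_apply, h2, smul_eq_mul]
    rfl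
  filter_upwards [h] with t ht
  rw [Finset.sum_apply]
  exact Finset.sum_congr rfl ht

lemma sum_indicator_Ico_eq {n : ℕ} (hn : 0 < n) (a : ℝ → ℝ) {t : ℝ} (ht : t ∈ Ioo (0 : ℝ) 1) :
    ∑ i ∈ Finset.range n, a (i / n) * (Ico (i / n : ℝ) ((i + 1) / n)).indicator 1 t =
      a (⌊n * t⌋₊ / n) := by
  have hn' : (0 : ℝ) < n := by exact_mod_cast hn
  have hnt : 0 ≤ n * t := by have := ht.1; positivity
  have key : ∀ i : ℕ, t ∈ Ico (i / n : ℝ) ((i + 1) / n) ↔ ⌊n * t⌋₊ = i := fun i => by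
    rw [Nat.floor_eq_iff hnt, mem_Ico, div_le_iff₀' hn', lt_div_iff₀' hn']
  rw [Finset.sum_eq_single ⌊n * t⌋₊]
  · rw [indicator_of_mem ((key _).2 rfl)]; simp
  · intro i _ hi
    rw [indicator_of_notMem (fun h => hi ((key i).1 h).symm), mul_zero]
  · intro h
    refine absurd (Finset.mem_range.2 ?_) h
    rw [Nat.floor_lt hnt]
    nlinarith [ht.2]

lemma norm_volterra_sub_volterraApprox_le {n : ℕ} (hn : 0 < n) :
    ‖volterra - volterraApprox n‖ ≤ √(1 / n) := by
  have hn' : (0 : ℝ) < n := by exact_mod_cast hn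
  refine ContinuousLinearMap.opNorm_le_bound _ (Real.sqrt_nonneg _) fun g => ?_
  refine norm_E_le_of_ae_bound (by positivity) ?_
  rw [sub_apply]
  filter_upwards [Lp.coeFn_sub (volterra g) (volterraApprox n g), coeFn_volterra g,
    coeFn_volterraApprox n g, ae_mem_Ioo_mu01] with t h1 h2 h3 ht
  rw [h1, Pi.sub_apply, h2, h3, sum_indicator_Ico_eq hn (U g) ht]
  have hnt : 0 ≤ n * t := by have := ht.1; positivity
  have hle : (⌊n * t⌋₊ / n : ℝ) ≤ t := by
    rw [div_le_iff₀' hn']; exact Nat.floor_le hnt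
  refine (abs_U_sub_le g (by positivity) hle).trans ?_
  gcongr
  rw [sub_le_iff_le_add, ← add_div, le_div_iff₀' hn', add_comm]
  exact (Nat.lt_floor_add_one _).le

lemma isCompactOperator_volterra : IsCompactOperator volterra := by
  refine isCompactOperator_of_tendsto (F := volterraApprox) (l := Filter.atTop) ?_ ?_
  · rw [tendsto_iff_norm_sub_tendsto_zero]
    have h0 : Filter.Tendsto (fun n : ℕ => √(1 / n)) Filter.atTop (nhds 0) := by
      simpa [Function.comp_def] using
        (Real.continuous_sqrt.tendsto 0).comp tendsto_one_div_atTop_nhds_zero_nat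
    refine squeeze_zero' (.of_forall fun _ => norm_nonneg _) ?_ h0
    filter_upwards [Filter.eventually_gt_atTop 0] with n hn
    rw [norm_sub_rev]
    exact norm_volterra_sub_volterraApprox_le hn
  · refine .of_forall fun n => ?_
    have h : volterraApprox n ∈ compactOperator (RingHom.id ℝ) E E := by
      refine Submodule.sum_mem _ fun i _ => ?_
      exact (isCompactOperator_of_locallyCompactSpace_rng
        (ContinuousLinearMap.toSpanSingleton ℝ _)).comp_clm
          (innerSL ℝ (indicatorConstLp 2 (measurableSet_Ioc (a := (0 : ℝ)) (b := i / n))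
            (measure_ne_top mu01 _) (1 : ℝ)))
    exact h

lemma exists_compact_Ltilde_eq_inner {rt : ℝ → ℝ} (hr : MemLp rt ∞ mu01) :
    ∃ K : E →L[ℝ] E, IsCompactOperator K ∧ ∀ g w : E, Ltilde rt g w = ⟪g - K g, w⟫ := by
  let M : E →L[ℝ] E := (ContinuousLinearMap.mul ℝ ℝ).holderL mu01 ∞ 2 2 (hr.toLp rt)
  have hM : ∀ g : E, (M g : ℝ → ℝ) =ᵐ[mu01] fun t => rt t * (g : ℝ → ℝ) t := fun g => by
    filter_upwards [(ContinuousLinearMap.mul ℝ ℝ).coeFn_holder (r := 2) (hr.toLp rt) g,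
      hr.coeFn_toLp] with t h1 h2
    rw [← h2]
    exact h1
  refine ⟨(ContinuousLinearMap.adjoint volterra).comp (M.comp volterra),
    (isCompactOperator_volterra.clm_comp M).clm_comp (ContinuousLinearMap.adjoint volterra),
    fun g w => ?_⟩
  rw [inner_sub_left, ContinuousLinearMap.comp_apply, ContinuousLinearMap.adjoint_inner_left,
    inner_E_eq, inner_E_eq, Ltilde]
  congr 1
  refine integral_congr_ae ?_
  filter_upwards [hM (volterra g), coeFn_volterra g, coeFn_volterra w] with t h1 h2 h3
  rw [ContinuousLinearMap.comp_apply, h1, h2, h3]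

/-- Fredholm alternative for `Ltilde`: injectivity implies surjectivity. -/
lemma Ltilde_surjective_of_injective {rt : ℝ → ℝ} (hr : MemLp rt ∞ mu01)
    (hinj : ∀ g : E, (∀ w : E, Ltilde rt g w = 0) → g = 0) (T : E →L[ℝ] ℝ) :
    ∃ g : E, ∀ w : E, Ltilde rt g w = T w := by
  obtain ⟨K, hK, hL⟩ := exists_compact_Ltilde_eq_inner hr
  rcases hK.hasEigenvalue_or_mem_resolventSet one_ne_zero with h | h
  · obtain ⟨g, hg⟩ := h.exists_hasEigenvector
    have hKg : K g = g := by simpa using hg.apply_eq_smul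
    exact absurd (hinj g fun w => by rw [hL, hKg, sub_self, inner_zero_left]) hg.2
  · rw [spectrum.mem_resolventSet_iff, map_one, ContinuousLinearMap.isUnit_iff_bijective] at h
    obtain ⟨g, hg⟩ := h.2 ((InnerProductSpace.toDual ℝ E).symm T)
    refine ⟨g, fun w => ?_⟩
    have hg' : g - K g = (InnerProductSpace.toDual ℝ E).symm T := by simpa using hg
    rw [hL, hg', InnerProductSpace.toDual_symm_apply]

lemma integrable_mul_U_mul_U {q : ℝ → ℝ} (hq : MemLp q ∞ mu01) (g w : E) :
    Integrable (fun s => q s * U g s * U w s) mu01 := by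
  have h : MemLp (fun s => q s * U g s) 2 mu01 := (memLp_U g).mul hq
  exact h.integrable_mul (memLp_U w)

lemma eigenEqSplit_one_of_Ltilde_eq_zero {rt : ℝ → ℝ} (hr : MemLp rt ∞ mu01) (δ : ℝ) {g : E}
    (hg : ∀ w : E, Ltilde rt g w = 0) : EigenEqSplit rt δ 1 g := by
  intro w
  have hp : MemLp (fun s => max (rt s) 0 + δ) ∞ mu01 := hr.pos_part.add (memLp_const δ)
  have hn : MemLp (fun s => max (-rt s) 0 + δ) ∞ mu01 := hr.neg_part.add (memLp_const δ)
  have h := hg w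
  have hsplit : ∫ s, rt s * U g s * U w s ∂mu01 =
      (∫ s, (max (rt s) 0 + δ) * U g s * U w s ∂mu01) -
        ∫ s, (max (-rt s) 0 + δ) * U g s * U w s ∂mu01 := by
    rw [← integral_sub (integrable_mul_U_mul_U hp g w) (integrable_mul_U_mul_U hn g w)]
    refine integral_congr_ae (.of_forall fun s => ?_)
    have h0 : max (rt s) 0 - max (-rt s) 0 = rt s := max_zero_sub_eq_self (rt s)
    linear_combination (-U g s * U w s) * h0
  rw [Ltilde, hsplit] at h
  linarith

lemma U_eq_intervalIntegral (g : E) {t : ℝ} (ht : t ∈ Ioo (0 : ℝ) 1) :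
    U g t = ∫ s in (0 : ℝ)..t, (g : ℝ → ℝ) s := by
  have h : Ioc 0 t ∩ Ioo 0 1 = Ioc 0 t :=
    inter_eq_left.2 fun s hs => ⟨hs.1, hs.2.trans_lt ht.2⟩
  have hm : mu01.restrict (Ioc 0 t) = volume.restrict (Ioc 0 t) := by
    rw [mu01, Measure.restrict_restrict measurableSet_Ioc, h]
  rw [U, hm, intervalIntegral.integral_of_le ht.1.le]

lemma integral_mu01_eq_intervalIntegral (f : ℝ → ℝ) :
    ∫ s, f s ∂mu01 = ∫ s in (0 : ℝ)..1, f s := by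
  rw [intervalIntegral.integral_of_le zero_le_one, integral_Ioc_eq_integral_Ioo, mu01]

lemma intervalIntegrable_iff_integrable_mu01 {f : ℝ → ℝ} :
    IntervalIntegrable f volume 0 1 ↔ Integrable f mu01 :=
  intervalIntegrable_iff_integrableOn_Ioo_of_le zero_le_one

/-- Poincaré inequality on `H^1_{0L}(I)`, for every constant below the optimal one. -/
lemma sq_mul_integral_U_sq_le {k : ℝ} (hk0 : 0 ≤ k) (hk : k < Real.pi / 2) (g : E) :
    k ^ 2 * ∫ s, U g s ^ 2 ∂mu01 ≤ ∫ s, (g : ℝ → ℝ) s ^ 2 ∂mu01 := by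
  set u : ℝ → ℝ := fun x => ∫ s in (0 : ℝ)..x, (g : ℝ → ℝ) s with hu
  set p : ℝ → ℝ := fun x => k * Real.tan (k * (1 - x)) with hp
  have hgi : IntervalIntegrable (g : ℝ → ℝ) volume 0 1 :=
    intervalIntegrable_iff_integrable_mu01.2 (integrable_E g)
  have hcos : ∀ x ∈ Icc (0 : ℝ) 1, Real.cos (k * (1 - x)) ≠ 0 := fun x hx =>
    (Real.cos_pos_of_mem_Ioo ⟨by nlinarith [hx.1, hx.2, Real.pi_pos],
      by nlinarith [hx.1, hx.2]⟩).ne'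
  have hpd : ∀ x ∈ Icc (0 : ℝ) 1, HasDerivAt p (-k ^ 2 - p x ^ 2) x := fun x hx => by
    have h1 : HasDerivAt (fun x : ℝ => k * (1 - x)) (k * -1) x :=
      ((hasDerivAt_id x).const_sub 1).const_mul k
    have h2 := ((Real.hasDerivAt_tan (hcos x hx)).comp x h1).const_mul k
    refine h2.congr_deriv ?_
    simp only [hp]
    rw [ Real.tan_eq_sin_div_cos]
    field_simp [hcos x hx]
    linear_combination k ^ 2 * Real.sin_sq_add_cos_sq (k * (1 - x))
  have hpc : ContDiffOn ℝ 1 p (uIcc 0 1) := by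
    rw [uIcc_of_le zero_le_one]
    intro x hx
    refine ContDiffAt.contDiffWithinAt ?_
    have h1 : ContDiffAt ℝ 1 (fun x : ℝ => k * (1 - x)) x := by fun_prop
    have h2 : ContDiffAt ℝ 1 (Real.tan ∘ fun x : ℝ => k * (1 - x)) x :=
      (Real.contDiffAt_tan.2 (hcos x hx)).comp x h1
    exact contDiffAt_const.mul h2
  have huac : AbsolutelyContinuousOnInterval u 0 1 :=
    hgi.absolutelyContinuousOnInterval_intervalIntegral (by simp)
  have hF := hpc.absolutelyContinuousOnInterval.mul (huac.mul huac)
  have hF0 : ∫ x in (0 : ℝ)..1, deriv (p * (u * u)) x = 0 := by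
    rw [hF.integral_deriv_eq_sub]
    simp [hp, hu]
  have hg2 : Integrable (fun s => (g : ℝ → ℝ) s ^ 2) mu01 := (Lp.memLp g).integrable_sq
  have hU2 : Integrable (fun s => k ^ 2 * U g s ^ 2) mu01 := (memLp_U g).integrable_sq.const_mul _
  have hle : ∫ x, deriv (p * (u * u)) x ∂mu01 ≤
      ∫ x, (g : ℝ → ℝ) x ^ 2 - k ^ 2 * U g x ^ 2 ∂mu01 := by
    refine integral_mono_ae (intervalIntegrable_iff_integrable_mu01.1 hF.intervalIntegrable_deriv)
      (hg2.sub hU2) ?_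
    filter_upwards [ae_mem_Ioo_mu01, ae_restrict_of_ae hgi.ae_hasDerivAt_integral] with x hx hd
    have hux : HasDerivAt u ((g : ℝ → ℝ) x) x :=
      hd (by rw [uIcc_of_le zero_le_one]; exact Ioo_subset_Icc_self hx) 0 (by simp)
    have hdx := (hpd x (Ioo_subset_Icc_self hx)).mul (hux.mul hux)
    simp only [hdx.deriv, U_eq_intervalIntegral g hx, Pi.mul_apply]
    change _ ≤ _ - k ^ 2 * u x ^ 2
    nlinarith [sq_nonneg ((g : ℝ → ℝ) x - p x * u x)]
  rw [integral_mu01_eq_intervalIntegral, hF0, integral_sub hg2 hU2, integral_const_mul] at hle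
  linarith

lemma eq_zero_of_Ltilde_eq_zero {rt : ℝ → ℝ} (hr : MemLp rt ∞ mu01) {M : ℝ}
    (hM : M < Real.pi ^ 2 / 4) (hrM : ∀ᵐ s ∂mu01, rt s ≤ M) {g : E}
    (hg : ∀ w : E, Ltilde rt g w = 0) : g = 0 := by
  obtain ⟨k, hk0, hk, hMk⟩ : ∃ k : ℝ, 0 ≤ k ∧ k < Real.pi / 2 ∧ M < k ^ 2 := by
    have hlt : √(max M 0) < Real.pi / 2 := by
      rw [Real.sqrt_lt' (by positivity)]
      exact max_lt (by linarith) (by positivity)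
    obtain ⟨k, hk1, hk2⟩ := exists_between hlt
    refine ⟨k, (Real.sqrt_nonneg _).trans hk1.le, hk2, ?_⟩
    exact (le_max_left M 0).trans_lt ((Real.sqrt_lt' ((Real.sqrt_nonneg _).trans_lt hk1)).1 hk1)
  have hU2 := (memLp_U g).integrable_sq
  have hpoin := sq_mul_integral_U_sq_le hk0 hk g
  have hle : ∫ s, rt s * U g s * U g s ∂mu01 ≤ M * ∫ s, U g s ^ 2 ∂mu01 := by
    rw [← integral_const_mul]
    refine integral_mono_ae (integrable_mul_U_mul_U hr g g) (hU2.const_mul M) ?_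
    filter_upwards [hrM] with s hs
    nlinarith [sq_nonneg (U g s)]
  have hL := hg g
  simp only [Ltilde, ← sq] at hL
  have hnn : 0 ≤ ∫ s, U g s ^ 2 ∂mu01 := integral_nonneg fun s => sq_nonneg _
  have hUz : ∫ s, U g s ^ 2 ∂mu01 = 0 := by nlinarith
  rw [hUz, mul_zero] at hle
  have hgg : ⟪g, g⟫ ≤ 0 := by
    simp only [inner_E_eq, ← sq]
    linarith
  rw [← inner_self_eq_zero (𝕜 := ℝ)]
  exact le_antisymm hgg real_inner_self_nonneg

/-- Theorem `teoSL`: let `r̃ ∈ L^∞(I)` and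
`L̃(u)(v) = ∫₀¹ u'v' − ∫₀¹ r̃uv`.  (i) If, for some `δ > 0`, `μ = 1` is not an eigenvalue
of `L̃_μ(u)(v) = ∫u'v' + ∫(r̃⁻+δ)uv − μ∫(r̃⁺+δ)uv`, then `L̃` is surjective onto
`(H^1_{0L}(I))'`.  (ii) In particular, `L̃` is surjective if `‖r̃⁺‖_∞ < c_p⁻² = π²/4`. -/
theorem Ltilde_surjective
    (rt : ℝ → ℝ) (hrm : Measurable rt)
    (hbd : ∃ C : ℝ, ∀ᵐ s ∂mu01, |rt s| ≤ C) :
    -- (i):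
    (∀ δ : ℝ, 0 < δ →
      (¬ ∃ g : E, g ≠ 0 ∧ EigenEqSplit rt δ 1 g) →
      ∀ T : E →L[ℝ] ℝ, ∃ g : E, ∀ w : E, Ltilde rt g w = T w) ∧
    -- (ii):
    ((∃ M : ℝ, M < Real.pi ^ 2 / 4 ∧ ∀ᵐ s ∂mu01, rt s ≤ M) →
      ∀ T : E →L[ℝ] ℝ, ∃ g : E, ∀ w : E, Ltilde rt g w = T w) := by
  obtain ⟨C, hC⟩ := hbd
  have hr : MemLp rt ∞ mu01 := memLp_top_of_bound hrm.aestronglyMeasurable C hC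
  refine ⟨fun δ _ hne => Ltilde_surjective_of_injective hr fun g hg => ?_,
    fun ⟨M, hM, hrM⟩ => Ltilde_surjective_of_injective hr fun g hg =>
      eq_zero_of_Ltilde_eq_zero hr hM hrM hg⟩
  by_contra hg0
  exact hne ⟨g, hg0, eigenEqSplit_one_of_Ltilde_eq_zero hr δ hg⟩
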